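/- As t tends to 0 from the right, the measures ρ_t dμ converge in the weak-* sense to the Dirac measure at 0: for every bounded continuous function g : ℚ_p → ℝ, lim_{t → 0⁺} ∫_{ℚ_p} g(x) ρ_t(x) dμ(x) = g(0). -/

import Mathlib

open MeasureTheory ENNReal

/-- The fundamental solution (transition density) of the `p`-adic diffusion equation for
the Vladimirov operator with exponent `b` and diffusion constant `σ`:
`ρ_t(x) = Σ_{r ∈ ℤ} (e^{−σtp^{rb}} − e^{−σtp^{(r+1)b}}) · p^r · 1_{‖x‖ ≤ p^{−r}}(x)`. -/
noncomputable def rho (p : ℕ) [Fact p.Prime] (b σ t : ℝ) (x : ℚ_[p]) : ℝ :=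
  ∑' r : ℤ,
    (Real.exp (-(σ * t * (p : ℝ) ^ ((r : ℝ) * b))) -
        Real.exp (-(σ * t * (p : ℝ) ^ (((r : ℝ) + 1) * b)))) *
      ((p : ℝ) ^ r *
        Set.indicator {y : ℚ_[p] | ‖y‖ ≤ (p : ℝ) ^ (-r)} (fun _ => (1 : ℝ)) x)

namespace Padic

variable {p : ℕ} [Fact p.Prime]

/-- A closed ball is a disjoint union of `p` translates of the next smaller one. -/
lemma setOf_norm_le_zpow_eq_biUnion (r : ℤ) :
    {x : ℚ_[p] | ‖x‖ ≤ (p : ℝ) ^ (-r)} = ⋃ j ∈ Finset.range p,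
      (fun x : ℚ_[p] ↦ x + -((j : ℚ_[p]) * (p : ℚ_[p]) ^ r)) ⁻¹'
        {x | ‖x‖ ≤ (p : ℝ) ^ (-(r + 1))} := by
  have hp : (0 : ℝ) < p := by exact_mod_cast (Fact.out : p.Prime).pos
  have hp0 : (p : ℚ_[p]) ≠ 0 := by exact_mod_cast (Fact.out : p.Prime).ne_zero
  ext x
  simp only [Set.mem_ofPred_eq, Set.mem_iUnion, Set.mem_preimage, Finset.mem_range, exists_prop]
  constructor
  · intro hx
    have hy : ‖x * (p : ℚ_[p]) ^ (-r)‖ ≤ 1 := by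
      rw [norm_mul, norm_p_zpow, neg_neg]
      calc ‖x‖ * (p : ℝ) ^ r ≤ (p : ℝ) ^ (-r) * (p : ℝ) ^ r := by gcongr
        _ = 1 := by rw [← zpow_add₀ hp.ne']; simp
    let y : ℤ_[p] := ⟨x * (p : ℚ_[p]) ^ (-r), hy⟩
    refine ⟨y.zmodRepr, y.zmodRepr_lt_p, ?_⟩
    have h := y.sub_zmodRepr_mem
    rw [IsLocalRing.mem_maximalIdeal, PadicInt.mem_nonunits, PadicInt.norm_def] at h
    push_cast at h
    have h1 : ‖(y : ℚ_[p]) - (y.zmodRepr : ℚ_[p])‖ ≤ (p : ℝ) ^ (-1 : ℤ) := by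
      have := (norm_lt_pow_iff_norm_le_pow_sub_one
        ((y : ℚ_[p]) - (y.zmodRepr : ℚ_[p])) 0).1 (by simpa using h)
      simpa using this
    have h2 : x + -((y.zmodRepr : ℚ_[p]) * (p : ℚ_[p]) ^ r)
        = ((y : ℚ_[p]) - (y.zmodRepr : ℚ_[p])) * (p : ℚ_[p]) ^ r := by
      have : (y : ℚ_[p]) = x * (p : ℚ_[p]) ^ (-r) := rfl
      rw [sub_mul, this, mul_assoc, ← zpow_add₀ hp0]
      simp [sub_eq_add_neg]
    rw [h2, norm_mul, norm_p_zpow, neg_add_rev, zpow_add₀ hp.ne']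
    gcongr
  · rintro ⟨j, -, hj⟩
    have h1 : ‖(j : ℚ_[p]) * (p : ℚ_[p]) ^ r‖ ≤ (p : ℝ) ^ (-r) := by
      rw [norm_mul, norm_p_zpow]
      exact mul_le_of_le_one_left (by positivity) (by simpa using norm_int_le_one (p := p) j)
    have h2 : (p : ℝ) ^ (-(r + 1)) ≤ (p : ℝ) ^ (-r) :=
      zpow_le_zpow_right₀ (by exact_mod_cast (Fact.out : p.Prime).one_le) (by lia)
    have := nonarchimedean (x + -((j : ℚ_[p]) * (p : ℚ_[p]) ^ r)) ((j : ℚ_[p]) * (p : ℚ_[p]) ^ r)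
    rw [neg_add_cancel_right] at this
    exact this.trans (max_le (hj.trans h2) h1)

lemma pairwiseDisjoint_translates_setOf_norm_le_zpow (r : ℤ) :
    (Finset.range p : Set ℕ).PairwiseDisjoint fun j ↦
      (fun x : ℚ_[p] ↦ x + -((j : ℚ_[p]) * (p : ℚ_[p]) ^ r)) ⁻¹'
        {x | ‖x‖ ≤ (p : ℝ) ^ (-(r + 1))} := by
  have hp : (0 : ℝ) < p := by exact_mod_cast (Fact.out : p.Prime).pos
  have hp1 : (1 : ℝ) < p := by exact_mod_cast (Fact.out : p.Prime).one_lt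
  intro i hi j hj hij
  refine Set.disjoint_left.2 fun x hxi hxj ↦ hij ?_
  simp only [Finset.coe_range, Set.mem_Iio, Set.mem_preimage, Set.mem_ofPred_eq] at hi hj hxi hxj
  have h := nonarchimedean (x + -((i : ℚ_[p]) * (p : ℚ_[p]) ^ r))
    (-(x + -((j : ℚ_[p]) * (p : ℚ_[p]) ^ r)))
  rw [norm_neg] at h
  replace h := h.trans (max_le hxi hxj)
  have h2 : x + -((i : ℚ_[p]) * (p : ℚ_[p]) ^ r) + -(x + -((j : ℚ_[p]) * (p : ℚ_[p]) ^ r))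
      = (((j : ℤ) - (i : ℤ) : ℤ) : ℚ_[p]) * (p : ℚ_[p]) ^ r := by
    push_cast; ring
  rw [h2, norm_mul, norm_p_zpow, neg_add_rev, zpow_add₀ hp.ne',
    mul_le_mul_iff_left₀ (by positivity)] at h
  have h3 : ‖(((j : ℤ) - (i : ℤ) : ℤ) : ℚ_[p])‖ < 1 :=
    h.trans_lt (by rw [zpow_neg_one]; exact inv_lt_one_of_one_lt₀ hp1)
  rw [norm_intCast_lt_one_iff] at h3
  have h4 := (Nat.modEq_iff_dvd.2 h3 : i ≡ j [MOD p])
  exact h4.eq_of_lt_of_lt hi hj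

lemma measure_setOf_norm_le_lt_top [MeasurableSpace ℚ_[p]] (μ : Measure ℚ_[p])
    [μ.IsAddHaarMeasure] (c : ℝ) :
    μ {x : ℚ_[p] | ‖x‖ ≤ c} < ∞ := by
  have h : {x : ℚ_[p] | ‖x‖ ≤ c} = Metric.closedBall 0 c := by ext; simp
  rw [h]
  exact (isCompact_closedBall 0 c).measure_lt_top

variable [MeasurableSpace ℚ_[p]] [BorelSpace ℚ_[p]]

lemma measurableSet_setOf_norm_le (c : ℝ) : MeasurableSet {x : ℚ_[p] | ‖x‖ ≤ c} :=
  (isClosed_le continuous_norm continuous_const).measurableSet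

lemma measure_setOf_norm_le_zpow (μ : Measure ℚ_[p]) [μ.IsAddHaarMeasure] (r : ℤ) :
    μ {x : ℚ_[p] | ‖x‖ ≤ (p : ℝ) ^ (-r)} = p * μ {x : ℚ_[p] | ‖x‖ ≤ (p : ℝ) ^ (-(r + 1))} := by
  rw [setOf_norm_le_zpow_eq_biUnion, measure_biUnion_finset
    (pairwiseDisjoint_translates_setOf_norm_le_zpow r)
    fun j _ ↦ (measurableSet_setOf_norm_le _).preimage (by fun_prop)]
  simp only [measure_preimage_add_right]
  simp

lemma measureReal_setOf_norm_le_zpow (μ : Measure ℚ_[p]) [μ.IsAddHaarMeasure]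
    (hμ : μ {x : ℚ_[p] | ‖x‖ ≤ 1} = 1) (r : ℤ) :
    μ.real {x : ℚ_[p] | ‖x‖ ≤ (p : ℝ) ^ (-r)} = (p : ℝ) ^ (-r) := by
  have hp : (p : ℝ) ≠ 0 := by exact_mod_cast (Fact.out : p.Prime).ne_zero
  have step (r : ℤ) : μ.real {x : ℚ_[p] | ‖x‖ ≤ (p : ℝ) ^ (-r)}
      = p * μ.real {x : ℚ_[p] | ‖x‖ ≤ (p : ℝ) ^ (-(r + 1))} := by
    rw [measureReal_def, measure_setOf_norm_le_zpow μ r, ENNReal.toReal_mul, ENNReal.toReal_natCast,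
      measureReal_def]
  induction r with
  | zero => simp [measureReal_def, hμ]
  | succ n ih =>
    rw [step] at ih
    refine mul_left_cancel₀ hp (ih.trans ?_)
    rw [← zpow_one_add₀ hp]
    congr 1
    ring
  | pred n ih =>
    rw [step, sub_add_cancel, ih, neg_sub', sub_neg_eq_add, zpow_add_one₀ hp, mul_comm]

/-- Averaging a function over a ball around `0` on which it is `ε`-close to `a`. -/
lemma abs_average_sub_le (μ : Measure ℚ_[p]) [μ.IsAddHaarMeasure]
    (hμ : μ {x : ℚ_[p] | ‖x‖ ≤ 1} = 1) {g : ℚ_[p] → ℝ} (hg : Continuous g) {a ε : ℝ} {r : ℤ}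
    (h : ∀ x : ℚ_[p], ‖x‖ ≤ (p : ℝ) ^ (-r) → |g x - a| ≤ ε) :
    |(p : ℝ) ^ r * ∫ x in {x : ℚ_[p] | ‖x‖ ≤ (p : ℝ) ^ (-r)}, g x ∂μ - a| ≤ ε := by
  have hp : (0 : ℝ) < p := by exact_mod_cast (Fact.out : p.Prime).pos
  have hm := measureReal_setOf_norm_le_zpow μ hμ r
  have hfin := measure_setOf_norm_le_lt_top μ ((p : ℝ) ^ (-r))
  have hK : {x : ℚ_[p] | ‖x‖ ≤ (p : ℝ) ^ (-r)} = Metric.closedBall 0 ((p : ℝ) ^ (-r)) := by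
    ext; simp
  have hint : IntegrableOn g {x : ℚ_[p] | ‖x‖ ≤ (p : ℝ) ^ (-r)} μ := by
    rw [hK]
    exact hg.continuousOn.integrableOn_compact (isCompact_closedBall _ _)
  have hpp : (p : ℝ) ^ r * (p : ℝ) ^ (-r) = 1 := by rw [← zpow_add₀ hp.ne']; simp
  have key : (p : ℝ) ^ r * ∫ x in {x : ℚ_[p] | ‖x‖ ≤ (p : ℝ) ^ (-r)}, g x ∂μ - a
      = (p : ℝ) ^ r * ∫ x in {x : ℚ_[p] | ‖x‖ ≤ (p : ℝ) ^ (-r)}, (g x - a) ∂μ := by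
    rw [integral_sub hint (integrableOn_const hfin.ne), setIntegral_const, hm, smul_eq_mul, mul_sub,
      ← mul_assoc, hpp, one_mul]
  have hb := norm_setIntegral_le_of_norm_le_const (f := fun x ↦ g x - a) hfin h
  rw [hm, Real.norm_eq_abs] at hb
  rw [key, abs_mul, abs_of_pos (by positivity)]
  calc _ ≤ (p : ℝ) ^ r * (ε * (p : ℝ) ^ (-r)) := by gcongr
    _ = ε := by rw [mul_left_comm, hpp, mul_one]

end Padic

open Filter Topology

lemma Antitone.hasSum_int_sub {E : ℤ → ℝ} (hE : Antitone E) {a b : ℝ}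
    (ha : Tendsto E atBot (𝓝 a)) (hb : Tendsto E atTop (𝓝 b)) :
    HasSum (fun r ↦ E r - E (r + 1)) (a - b) := by
  have h1 : HasSum (fun n : ℕ ↦ E n - E ((n : ℤ) + 1)) (E 0 - b) := by
    rw [hasSum_iff_tendsto_nat_of_nonneg fun n ↦ sub_nonneg.2 (hE (by lia))]
    have (n : ℕ) : ∑ i ∈ Finset.range n, (E i - E ((i : ℤ) + 1)) = E 0 - E n := by
      simpa using Finset.sum_range_sub' (fun i : ℕ ↦ E i) n
    simp only [this]
    exact (hb.comp tendsto_natCast_atTop_atTop).const_sub _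
  have h2 : HasSum (fun n : ℕ ↦ E (-((n : ℤ) + 1)) - E (-((n : ℤ) + 1) + 1)) (a - E 0) := by
    rw [hasSum_iff_tendsto_nat_of_nonneg fun n ↦ sub_nonneg.2 (hE (by lia))]
    have (n : ℕ) : ∑ i ∈ Finset.range n, (E (-((i : ℤ) + 1)) - E (-((i : ℤ) + 1) + 1))
        = E (-n) - E 0 := by
      simpa using Finset.sum_range_sub (fun i : ℕ ↦ E (-i)) n
    simp only [this]
    have hneg : Tendsto (fun n : ℕ ↦ -(n : ℤ)) atTop atBot :=
      tendsto_neg_atTop_atBot.comp tendsto_natCast_atTop_atTop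
    exact (ha.comp hneg).sub_const _
  have h := HasSum.of_nat_of_neg_add_one (f := fun r ↦ E r - E (r + 1)) h1 h2
  rwa [show E 0 - b + (a - E 0) = a - b by ring] at h

/-- If `A` is within `ε` of `a` from `N` on and within `D` everywhere, then so is, up to the mass
placed below `N`, its average against the weights `E r - E (r + 1)` of total mass `1`. -/
lemma Antitone.abs_tsum_sub_mul_sub_le {E A : ℤ → ℝ} (hE : Antitone E)
    (h1 : Tendsto E atBot (𝓝 1)) (h0 : Tendsto E atTop (𝓝 0)) {a ε D : ℝ} {N : ℤ}
    (hN : ∀ r, N ≤ r → |A r - a| ≤ ε) (hε : 0 ≤ ε) (hD : ∀ r, |A r - a| ≤ D)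
    {S : ℝ} (hS : HasSum (fun r ↦ (E r - E (r + 1)) * A r) S) :
    |S - a| ≤ ε + D * (1 - E N) := by
  have hc := hE.hasSum_int_sub h1 h0
  have hE' : Antitone fun r ↦ E (min r N) := fun r s h ↦ hE (min_le_min_right N h)
  have hc' := hE'.hasSum_int_sub (a := 1) (b := E N)
    (h1.congr' ((eventually_le_atBot N).mono fun r hr ↦ by simp [hr]))
    (tendsto_const_nhds.congr' ((eventually_ge_atTop N).mono fun r hr ↦ by simp [hr]))
  have hd : HasSum (fun r ↦ (E r - E (r + 1)) * (A r - a)) (S - a) := by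
    simpa [mul_sub] using hS.sub (hc.mul_right a)
  have hu := (hc.mul_right ε).add (hc'.mul_left D)
  rw [sub_zero, one_mul] at hu
  rw [← Real.norm_eq_abs, ← hd.tsum_eq]
  refine tsum_of_norm_bounded hu fun r ↦ ?_
  have hr : 0 ≤ E r - E (r + 1) := sub_nonneg.2 (hE (by lia))
  have hDN : 0 ≤ D := (abs_nonneg _).trans (hD 0)
  rw [norm_mul, Real.norm_of_nonneg hr, Real.norm_eq_abs]
  rcases le_or_gt N r with h | h
  · rw [min_eq_right h, min_eq_right (h.trans (by lia)), sub_self, mul_zero, add_zero]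
    exact mul_le_mul_of_nonneg_left (hN r h) hr
  · rw [min_eq_left h.le, min_eq_left (by lia), mul_comm D]
    have := mul_le_mul_of_nonneg_left (hD r) hr
    have := mul_nonneg hr hε
    linarith

section ExpRpow

variable {c q b : ℝ}

lemma antitone_exp_neg_mul_rpow (hc : 0 ≤ c) (hq : 1 ≤ q) (hb : 0 ≤ b) :
    Antitone fun r : ℤ ↦ Real.exp (-(c * q ^ ((r : ℝ) * b))) := by
  intro r s h
  have : (r : ℝ) ≤ s := by exact_mod_cast h
  dsimp only
  gcongr

lemma tendsto_exp_neg_mul_rpow_atBot (hq : 1 < q) (hb : 0 < b) :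
    Tendsto (fun r : ℤ ↦ Real.exp (-(c * q ^ ((r : ℝ) * b)))) atBot (𝓝 1) := by
  have h := (tendsto_rpow_atBot_of_base_gt_one q hq).comp
    (((tendsto_intCast_atBot_iff (R := ℝ)).2 tendsto_id).atBot_mul_const hb)
  simpa using ((h.const_mul c).neg).rexp

lemma tendsto_exp_neg_mul_rpow_atTop (hc : 0 < c) (hq : 1 < q) (hb : 0 < b) :
    Tendsto (fun r : ℤ ↦ Real.exp (-(c * q ^ ((r : ℝ) * b)))) atTop (𝓝 0) := by
  have h := (tendsto_rpow_atTop_of_base_gt_one q hq).comp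
    ((tendsto_intCast_atTop_atTop (R := ℝ)).atTop_mul_const hb)
  exact Real.tendsto_exp_neg_atTop_nhds_zero.comp (h.const_mul_atTop hc)

end ExpRpow

/-- Integrating against `ρ_t` is averaging over the balls around `0`. -/
lemma hasSum_integral_mul_rho {p : ℕ} [Fact p.Prime]
    [MeasurableSpace ℚ_[p]] [BorelSpace ℚ_[p]] (μ : Measure ℚ_[p]) [μ.IsAddHaarMeasure]
    (hμ : μ {x : ℚ_[p] | ‖x‖ ≤ 1} = 1) {b σ t : ℝ} (hb : 0 < b) (hσ : 0 < σ) (ht : 0 < t)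
    {g : ℚ_[p] → ℝ} (hg : Continuous g) {C : ℝ} (hC : ∀ x, |g x| ≤ C) :
    HasSum (fun r : ℤ ↦ (Real.exp (-(σ * t * (p : ℝ) ^ ((r : ℝ) * b))) -
        Real.exp (-(σ * t * (p : ℝ) ^ (((r + 1 : ℤ) : ℝ) * b)))) *
      ((p : ℝ) ^ r * ∫ x in {x : ℚ_[p] | ‖x‖ ≤ (p : ℝ) ^ (-r)}, g x ∂μ))
      (∫ x, g x * rho p b σ t x ∂μ) := by
  have hp1 : (1 : ℝ) < p := by exact_mod_cast (Fact.out : p.Prime).one_lt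
  have hp : (0 : ℝ) < p := one_pos.trans hp1
  have hE := antitone_exp_neg_mul_rpow (mul_pos hσ ht).le hp1.le hb.le
  have hsum := hE.hasSum_int_sub (tendsto_exp_neg_mul_rpow_atBot hp1 hb)
    (tendsto_exp_neg_mul_rpow_atTop (mul_pos hσ ht) hp1 hb)
  set w : ℤ → ℝ := fun r ↦ Real.exp (-(σ * t * (p : ℝ) ^ ((r : ℝ) * b))) -
    Real.exp (-(σ * t * (p : ℝ) ^ (((r + 1 : ℤ) : ℝ) * b))) with hw
  have hw0 (r : ℤ) : 0 ≤ w r := sub_nonneg.2 (hE (by lia))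
  let F : ℤ → ℚ_[p] → ℝ := fun r ↦
    {x : ℚ_[p] | ‖x‖ ≤ (p : ℝ) ^ (-r)}.indicator fun x ↦ w r * (p : ℝ) ^ r * g x
  have hmeas (r : ℤ) := Padic.measurableSet_setOf_norm_le (p := p) ((p : ℝ) ^ (-r))
  have hFint (r : ℤ) : Integrable (F r) μ := by
    rw [integrable_indicator_iff (hmeas r)]
    have hK : {x : ℚ_[p] | ‖x‖ ≤ (p : ℝ) ^ (-r)} = Metric.closedBall 0 ((p : ℝ) ^ (-r)) := by
      ext; simp
    rw [hK]
    exact (hg.const_mul _).continuousOn.integrableOn_compact (isCompact_closedBall _ _)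
  have hFnorm (r : ℤ) : ∫ x, ‖F r x‖ ∂μ ≤ w r * C := by
    have h := Padic.abs_average_sub_le μ hμ hg.abs (a := 0) (ε := C) (r := r)
      fun x _ ↦ by simpa using hC x
    simp only [F, norm_indicator_eq_indicator_norm]
    rw [integral_indicator (hmeas r)]
    simp only [norm_mul, Real.norm_eq_abs, abs_of_nonneg (hw0 r), abs_of_pos (zpow_pos hp r)]
    rw [integral_const_mul, mul_assoc]
    rw [sub_zero] at h
    exact mul_le_mul_of_nonneg_left ((le_abs_self _).trans h) (hw0 r)
  have hmain := hasSum_integral_of_summable_integral_norm hFint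
    (Summable.of_nonneg_of_le (fun r ↦ integral_nonneg fun x ↦ norm_nonneg _) hFnorm
      (hsum.summable.mul_right C))
  have hF (r : ℤ) : ∫ x, F r x ∂μ =
      w r * ((p : ℝ) ^ r * ∫ x in {x : ℚ_[p] | ‖x‖ ≤ (p : ℝ) ^ (-r)}, g x ∂μ) := by
    rw [integral_indicator (hmeas r), integral_const_mul, mul_assoc]
  have hrho (x : ℚ_[p]) : ∑' r, F r x = g x * rho p b σ t x := by
    rw [rho, ← tsum_mul_left]
    refine tsum_congr fun r ↦ ?_
    simp only [F, hw, Set.indicator_apply]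
    push_cast
    split_ifs <;> ring
  simpa only [hF, hrho] using hmain

/-- As `t → 0⁺`, the measures `ρ_t dμ` converge weak-* to the Dirac measure at `0`:
for every bounded continuous `g : ℚ_p → ℝ`,
`lim_{t → 0⁺} ∫ g(x) ρ_t(x) dμ(x) = g(0)`. -/
theorem stmt_7 (p : ℕ) [Fact p.Prime]
    [MeasurableSpace ℚ_[p]] [BorelSpace ℚ_[p]]
    (μ : Measure ℚ_[p]) [μ.IsAddHaarMeasure]
    (hμ : μ {x : ℚ_[p] | ‖x‖ ≤ 1} = 1)
    (b σ : ℝ) (hb : 0 < b) (hσ : 0 < σ)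
    (g : ℚ_[p] → ℝ) (hg : Continuous g) (hbd : ∃ C : ℝ, ∀ x, |g x| ≤ C) :
    Filter.Tendsto (fun t : ℝ => ∫ x, g x * rho p b σ t x ∂μ)
      (nhdsWithin 0 (Set.Ioi 0)) (nhds (g 0)) := by
  obtain ⟨C, hC⟩ := hbd
  have hp1 : (1 : ℝ) < p := by exact_mod_cast (Fact.out : p.Prime).one_lt
  rw [Metric.tendsto_nhds]
  intro ε hε
  obtain ⟨δ, hδ, hgδ⟩ := Metric.continuous_iff.1 hg 0 (ε / 2) (half_pos hε)
  obtain ⟨N, hN⟩ : ∃ N : ℕ, (p : ℝ)⁻¹ ^ N < δ :=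
    exists_pow_lt_of_lt_one hδ (inv_lt_one_of_one_lt₀ hp1)
  have hlim : Tendsto (fun t : ℝ ↦ ε / 2 + 2 * C *
      (1 - Real.exp (-(σ * t * (p : ℝ) ^ (((N : ℤ) : ℝ) * b))))) (𝓝[>] 0) (𝓝 (ε / 2)) := by
    refine Tendsto.mono_left ?_ nhdsWithin_le_nhds
    have : Continuous fun t : ℝ ↦ ε / 2 + 2 * C *
      (1 - Real.exp (-(σ * t * (p : ℝ) ^ (((N : ℤ) : ℝ) * b)))) := by fun_prop
    simpa using this.tendsto 0
  filter_upwards [hlim.eventually_lt_const (half_lt_self hε), self_mem_nhdsWithin] with t hlt ht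
  have ht : 0 < t := ht
  refine lt_of_le_of_lt ?_ hlt
  rw [Real.dist_eq]
  refine (antitone_exp_neg_mul_rpow (mul_pos hσ ht).le hp1.le hb.le).abs_tsum_sub_mul_sub_le
    (tendsto_exp_neg_mul_rpow_atBot hp1 hb)
    (tendsto_exp_neg_mul_rpow_atTop (mul_pos hσ ht) hp1 hb) (fun r hr ↦ ?_) (half_pos hε).le
    (fun r ↦ ?_) (hasSum_integral_mul_rho μ hμ hb hσ ht hg hC)
  · refine Padic.abs_average_sub_le μ hμ hg fun x hx ↦ ?_
    have hxN : ‖x‖ < δ := calc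
      ‖x‖ ≤ (p : ℝ) ^ (-r) := hx
      _ ≤ (p : ℝ) ^ (-(N : ℤ)) := zpow_le_zpow_right₀ hp1.le (by lia)
      _ = (p : ℝ)⁻¹ ^ N := by simp
      _ < δ := hN
    exact (hgδ x (by simpa using hxN)).le
  · refine Padic.abs_average_sub_le μ hμ hg fun x _ ↦ ?_
    have := abs_sub (g x) (g 0)
    linarith [hC x, hC 0]
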